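/- Let $(X,\sigma_X)$, $(Y,\sigma_Y)$ be one-sided subshifts, $\pi:X\to Y$ a one-block factor map, $f\in C(X)$, $h\in C(Y)$, and suppose $P(\sigma_X,\pi,f)(y) = \limsup_n \frac1n\log g_n(y)$ holds $m$-a.e. for every invariant measure $m$ on $Y$, where $g_n$ is defined from $f$ as in the fiberwise sum. If $m(\{y : P(\sigma_X,\pi,f - h\circ\pi)(y) = 0\}) = 1$ for every $m \in M(Y,\sigma_Y)$, then $\int P(\sigma_X,\pi,f)\,dm = \int h\,dm$ for every $m \in M(Y,\sigma_Y)$. -/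

import Mathlib

open Filter Topology MeasureTheory

/-- The shift map on the full one-sided shift on `k` symbols. -/
def shiftMap {k : ℕ} : (ℕ → Fin k) → (ℕ → Fin k) := fun x n => x (n + 1)

/-- A one-sided subshift: a closed, shift-invariant subset of the full shift. -/
def IsSubshift {k : ℕ} (X : Set (ℕ → Fin k)) : Prop :=
  IsClosed X ∧ ∀ x ∈ X, shiftMap x ∈ X

/-- Birkhoff sum `S_n h = ∑_{i<n} h ∘ T^i`. -/
noncomputable def birk {α : Type*} (T : α → α) (h : α → ℝ) (n : ℕ) (x : α) : ℝ :=
  ∑ i ∈ Finset.range n, h (T^[i] x)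

/-- The word `u` of length `n` appears in (is allowable for) the subshift `X`. -/
def WordIn {k : ℕ} (X : Set (ℕ → Fin k)) {n : ℕ} (u : Fin n → Fin k) : Prop :=
  ∃ x ∈ X, ∀ i : Fin n, x (i : ℕ) = u i

/-- The cylinder set of the word `u` inside the subshift `X`. -/
def cylSet {k : ℕ} (X : Set (ℕ → Fin k)) {n : ℕ} (u : Fin n → Fin k) : Set X :=
  {x : X | ∀ i : Fin n, (x : ℕ → Fin k) (i : ℕ) = u i}

/-- The periodic sequence `(u)^∞` obtained by repeating the word `u`. -/
def periodize {k p : ℕ} (hp : 0 < p) (u : Fin p → Fin k) : ℕ → Fin k :=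
  fun i => u ⟨i % p, Nat.mod_lt i hp⟩

/-- A sequence `{log f_n}` is asymptotically additive on the subshift `X` (with shift `σ`)
if for every `ε > 0` there is a continuous `ρ` with
`limsup_n (1/n)‖log f_n - S_n ρ‖_∞ < ε`. -/
def AsympAdd {k : ℕ} (X : Set (ℕ → Fin k)) (σ : X → X) (f : ℕ → X → ℝ) : Prop :=
  ∀ ε : ℝ, 0 < ε → ∃ ρ : X → ℝ, Continuous ρ ∧
    Filter.limsup
      (fun n : ℕ => (1 / (n : ℝ)) * ⨆ x : X, |Real.log (f n x) - birk σ ρ n x|)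
      Filter.atTop < ε

/-- Measure-theoretic entropy of a measure on a one-sided subshift, computed with the
canonical generating partition into cylinders. -/
noncomputable def mEntropy {k : ℕ} (X : Set (ℕ → Fin k)) (μ : MeasureTheory.Measure X) : ℝ :=
  Filter.liminf
    (fun n : ℕ => (1 / (n : ℝ)) *
      ∑ u : Fin n → Fin k, Real.negMulLog ((μ (cylSet X u)).toReal))
    Filter.atTop

-- The standard metric on the full shift: `d(x,y) = (1/2)^{min{i : x_i ≠ y_i}}`.
open Classical in
noncomputable def dSeq {k : ℕ} (x y : ℕ → Fin k) : ℝ :=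
  if x = y then 0 else (1 / 2 : ℝ) ^ (sInf {i : ℕ | x i ≠ y i})

/-- `P_n(σ, π, f, δ)(y)`: supremum of `∑_{x ∈ E} e^{S_n f(x)}` over `(n,δ)`-separated
subsets `E` of the fiber `π⁻¹(y)`. -/
noncomputable def relPn {k l : ℕ} (X : Set (ℕ → Fin k)) (σ : X → X)
    (πs : X → (ℕ → Fin l)) (f : X → ℝ) (n : ℕ) (δ : ℝ) (y : ℕ → Fin l) : ℝ :=
  sSup {s : ℝ | ∃ E : Finset X, (∀ x ∈ E, πs x = y) ∧
    (∀ x ∈ E, ∀ x' ∈ E, x ≠ x' →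
      ∃ i < n, δ ≤ dSeq ((σ^[i] x : X) : ℕ → Fin k) ((σ^[i] x' : X) : ℕ → Fin k)) ∧
    s = ∑ x ∈ E, Real.exp (birk σ f n x)}

/-- The relative pressure function `P(σ, π, f) : (ℕ → Fin l) → ℝ` of `f`. -/
noncomputable def relP {k l : ℕ} (X : Set (ℕ → Fin k)) (σ : X → X)
    (πs : X → (ℕ → Fin l)) (f : X → ℝ) (y : ℕ → Fin l) : ℝ :=
  ⨆ δ : {δ : ℝ // 0 < δ},
    Filter.limsup (fun n : ℕ => (1 / (n : ℝ)) * Real.log (relPn X σ πs f n δ.1 y))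
      Filter.atTop

/-- `g_n(y) = sup_{E_n(y)} ∑_{x ∈ E_n(y)} e^{S_n f(x)}`, where `E_n(y)` consists of exactly
one point from each cylinder `[x_1…x_n]` of `X` whose word is mapped by the one-block map
to `y_1…y_n`. -/
noncomputable def gfun {k l : ℕ} (X : Set (ℕ → Fin k)) (σ : X → X)
    (πs : X → (ℕ → Fin l)) (f : X → ℝ) (n : ℕ) (y : ℕ → Fin l) : ℝ :=
  sSup {s : ℝ | ∃ E : Finset X,
    (∀ x ∈ E, ∀ i : Fin n, πs x (i : ℕ) = y (i : ℕ)) ∧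
    (∀ x ∈ E, ∀ x' ∈ E, (∀ i : Fin n, (x : ℕ → Fin k) (i : ℕ) = (x' : ℕ → Fin k) (i : ℕ)) →
      x = x') ∧
    (∀ u : Fin n → Fin k,
      (∃ z : X, (∀ i : Fin n, (z : ℕ → Fin k) (i : ℕ) = u i) ∧
        ∀ i : Fin n, πs z (i : ℕ) = y (i : ℕ)) →
      ∃ x ∈ E, ∀ i : Fin n, (x : ℕ → Fin k) (i : ℕ) = u i) ∧
    s = ∑ x ∈ E, Real.exp (birk σ f n x)}


section Birkhoff

variable {α : Type*}

lemma birk_succ' (T : α → α) (g : α → ℝ) (n : ℕ) (x : α) :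
    birk T g (n + 1) x = g x + birk T g n (T x) := by
  unfold birk
  rw [Finset.sum_range_succ']
  simp [Function.iterate_succ_apply, add_comm]

lemma birk_abs_le {T : α → α} {g : α → ℝ} {C : ℝ} (hC : ∀ x, |g x| ≤ C) (n : ℕ) (x : α) :
    |birk T g n x| ≤ n * C := by
  unfold birk
  refine (Finset.abs_sum_le_sum_abs _ _).trans ?_
  refine (Finset.sum_le_sum (fun i _ => hC _)).trans ?_
  simp

lemma avg_abs_le {T : α → α} {g : α → ℝ} {C : ℝ} (hC : ∀ x, |g x| ≤ C) (n : ℕ) (x : α) :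
    |1 / (n : ℝ) * birk T g n x| ≤ C := by
  rcases Nat.eq_zero_or_pos n with rfl | hn
  · simpa using (abs_nonneg _).trans (hC x)
  · have hn' : (0 : ℝ) < n := by exact_mod_cast hn
    rw [abs_mul, abs_of_pos (by positivity : (0 : ℝ) < 1 / n), one_div, inv_mul_le_iff₀ hn']
    exact birk_abs_le hC n x

lemma bdd_of_abs {u : ℕ → ℝ} {C : ℝ} (hC : ∀ n, |u n| ≤ C) :
    IsBoundedUnder (· ≤ ·) atTop u ∧ IsBoundedUnder (· ≥ ·) atTop u ∧
    IsCoboundedUnder (· ≤ ·) atTop u ∧ IsCoboundedUnder (· ≥ ·) atTop u := by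
  have h1 : IsBoundedUnder (· ≤ ·) atTop u := isBoundedUnder_of ⟨C, fun n => (abs_le.1 (hC n)).2⟩
  have h2 : IsBoundedUnder (· ≥ ·) atTop u := isBoundedUnder_of ⟨-C, fun n => (abs_le.1 (hC n)).1⟩
  exact ⟨h1, h2, h2.isCoboundedUnder_flip, h1.isCoboundedUnder_flip⟩

/-- Adding a convergent sequence to a bounded one shifts the limsup by the limit. -/
lemma limsup_sub_tendsto {u v : ℕ → ℝ} {C c : ℝ} (hC : ∀ n, |u n| ≤ C)
    (hv : Tendsto v atTop (𝓝 c)) :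
    limsup (fun n => u n - v n) atTop = limsup u atTop - c := by
  obtain ⟨u1, u2, u3, u4⟩ := bdd_of_abs hC
  have hv' : Tendsto (fun n => - v n) atTop (𝓝 (-c)) := hv.neg
  have key := limsup_add_le (f := atTop) (u := fun n => - v n) (v := u)
    hv'.isBoundedUnder_ge hv'.isBoundedUnder_le u3 u1
  have key2 := le_limsup_add (f := atTop) (u := u) (v := fun n => - v n)
    u1 u3 hv'.isBoundedUnder_le hv'.isBoundedUnder_ge
  have e1 : (fun n => - v n) + u = fun n => u n - v n := by ext n; simp; ring
  have e2 : u + (fun n => - v n) = fun n => u n - v n := by ext n; simp; ring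
  rw [e1, hv'.limsup_eq] at key
  rw [e2, hv'.liminf_eq] at key2
  linarith

/-- Garsia's maximal function. -/
noncomputable def garsia (T : α → α) (g : α → ℝ) : ℕ → α → ℝ
  | 0 => fun _ => 0
  | n + 1 => fun x => max 0 (g x + garsia T g n (T x))

lemma garsia_nonneg (T : α → α) (g : α → ℝ) (n : ℕ) (x : α) : 0 ≤ garsia T g n x := by
  cases n <;> simp [garsia]

lemma garsia_le_succ (T : α → α) (g : α → ℝ) (n : ℕ) (x : α) :
    garsia T g n x ≤ garsia T g (n + 1) x := by
  induction n generalizing x with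
  | zero => simp [garsia]
  | succ n ih =>
    simp only [garsia] at ih ⊢
    gcongr
    exact ih _

lemma garsia_mono (T : α → α) (g : α → ℝ) (x : α) : Monotone fun n => garsia T g n x :=
  monotone_nat_of_le_succ (garsia_le_succ T g · x)

lemma birk_le_garsia (T : α → α) (g : α → ℝ) (n : ℕ) (x : α) :
    birk T g n x ≤ garsia T g n x := by
  induction n generalizing x with
  | zero => simp [garsia, birk]
  | succ n ih =>
    rw [birk_succ']
    simp only [garsia]
    exact le_max_of_le_right (by linarith [ih (T x)])

lemma garsia_le {T : α → α} {g : α → ℝ} {C : ℝ} (hC : ∀ x, |g x| ≤ C) (n : ℕ) (x : α) :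
    garsia T g n x ≤ n * C := by
  induction n generalizing x with
  | zero => simp [garsia]
  | succ n ih =>
    simp only [garsia]
    have h0 : 0 ≤ C := (abs_nonneg _).trans (hC x)
    have := (abs_le.1 (hC x)).2
    have := ih (T x)
    push_cast
    apply max_le
    · positivity
    · linarith

variable [MeasurableSpace α]

lemma garsia_meas {T : α → α} {g : α → ℝ} (hT : Measurable T) (hg : Measurable g) (n : ℕ) :
    Measurable (garsia T g n) := by
  induction n with
  | zero => exact measurable_const
  | succ n ih => exact measurable_const.max (hg.add (ih.comp hT))

lemma birk_meas {T : α → α} {g : α → ℝ} (hT : Measurable T) (hg : Measurable g) (n : ℕ) :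
    Measurable (birk T g n) := by
  unfold birk
  exact Finset.measurable_sum _ (fun i _ => hg.comp (hT.iterate i))

lemma integrable_of_abs {ν : Measure α} [IsProbabilityMeasure ν] {g : α → ℝ} {C : ℝ}
    (hg : Measurable g) (hC : ∀ x, |g x| ≤ C) : Integrable g ν :=
  Integrable.of_bound hg.aestronglyMeasurable C (ae_of_all _ hC)

/-- Maximal ergodic inequality. -/
lemma maximal_ergodic {ν : Measure α} [IsProbabilityMeasure ν] {T : α → α} {g : α → ℝ} {C : ℝ}
    (hT : MeasurePreserving T ν ν) (hg : Measurable g) (hC : ∀ x, |g x| ≤ C) (n : ℕ) :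
    0 ≤ ∫ x, {x | 0 < garsia T g (n + 1) x}.indicator g x ∂ν := by
  have hM := garsia_meas hT.measurable hg (n + 1)
  have hMi : Integrable (garsia T g (n + 1)) ν :=
    integrable_of_abs hM (C := (n + 1 : ℕ) * C) (fun x => by
      rw [abs_of_nonneg (garsia_nonneg _ _ _ _)]; exact garsia_le hC _ x)
  have hMT : Integrable (fun x => garsia T g (n + 1) (T x)) ν := hT.integrable_comp_of_integrable hMi
  have hE : MeasurableSet {x | 0 < garsia T g (n + 1) x} := measurableSet_lt measurable_const hM
  have hI : ∫ x, garsia T g (n + 1) (T x) ∂ν = ∫ x, garsia T g (n + 1) x ∂ν := by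
    conv_rhs => rw [← hT.map_eq]
    rw [integral_map hT.measurable.aemeasurable hM.aestronglyMeasurable]
  have h0 : ∫ x, (garsia T g (n + 1) x - garsia T g (n + 1) (T x)) ∂ν = 0 := by
    rw [integral_sub hMi hMT, hI, sub_self]
  refine h0.symm.le.trans ?_
  refine integral_mono (f := fun x => garsia T g (n + 1) x - garsia T g (n + 1) (T x))
    (hMi.sub hMT) ((integrable_of_abs hg hC).indicator hE) ?_
  intro x
  by_cases hx : 0 < garsia T g (n + 1) x
  · simp only [Set.indicator, Set.mem_ofPred_eq, hx, if_true]
    have h1 := garsia_le_succ T g n (T x)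
    have h2 : garsia T g (n + 1) x = g x + garsia T g n (T x) := by
      have h3 : garsia T g (n + 1) x = max 0 (g x + garsia T g n (T x)) := rfl
      rcases max_choice 0 (g x + garsia T g n (T x)) with h4 | h4
      · rw [h3, h4] at hx; exact absurd hx (lt_irrefl _)
      · rw [h3, h4]
    linarith
  · simp only [Set.indicator, Set.mem_ofPred_eq, hx, if_false]
    have := garsia_nonneg T g (n + 1) (T x)
    linarith

/-- If every point has some positive Birkhoff sum then the integral is nonnegative. -/
lemma integral_nonneg_of_birk_pos {ν : Measure α} [IsProbabilityMeasure ν] {T : α → α}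
    {g : α → ℝ} {C : ℝ}
    (hT : MeasurePreserving T ν ν) (hg : Measurable g) (hC : ∀ x, |g x| ≤ C)
    (hpos : ∀ x, ∃ n, 0 < birk T g n x) : 0 ≤ ∫ x, g x ∂ν := by
  have hlim : Tendsto (fun n : ℕ => ∫ x, {x | 0 < garsia T g (n + 1) x}.indicator g x ∂ν) atTop
      (𝓝 (∫ x, g x ∂ν)) := by
    apply tendsto_integral_of_dominated_convergence (fun _ => C)
    · intro n
      exact (hg.indicator (measurableSet_lt measurable_const
        (garsia_meas hT.measurable hg (n + 1)))).aestronglyMeasurable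
    · exact integrable_const C
    · intro n
      refine ae_of_all _ fun x => ?_
      exact (norm_indicator_le_norm_self _ _).trans (hC x)
    · refine ae_of_all _ fun x => ?_
      obtain ⟨N, hN⟩ := hpos x
      apply tendsto_const_nhds.congr'
      filter_upwards [eventually_ge_atTop N] with n hn
      have : 0 < garsia T g (n + 1) x :=
        hN.trans_le ((birk_le_garsia T g N x).trans (garsia_mono T g x (by omega)))
      simp [Set.indicator, this]
  exact ge_of_tendsto' hlim (maximal_ergodic hT hg hC)

/-- The upper Birkhoff average. -/
noncomputable def upAvg (T : α → α) (g : α → ℝ) (x : α) : ℝ :=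
  limsup (fun n : ℕ => 1 / (n : ℝ) * birk T g n x) atTop

lemma upAvg_abs_le {T : α → α} {g : α → ℝ} {C : ℝ} (hC : ∀ x, |g x| ≤ C) (x : α) :
    |upAvg T g x| ≤ C := by
  have hb := fun n => avg_abs_le (T := T) hC n x
  obtain ⟨u1, u2, u3, u4⟩ := bdd_of_abs hb
  rw [abs_le]
  constructor
  · exact le_limsup_of_frequently_le (Eventually.frequently (Eventually.of_forall
      fun n => (abs_le.1 (hb n)).1)) u1
  · exact limsup_le_of_le u3 (Eventually.of_forall fun n => (abs_le.1 (hb n)).2)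

lemma upAvg_comp {T : α → α} {g : α → ℝ} {C : ℝ} (hC : ∀ x, |g x| ≤ C) (x : α) :
    upAvg T g (T x) = upAvg T g x := by
  have hb := fun n => avg_abs_le (T := T) hC n x
  have ht : Tendsto (fun n : ℕ => 1 / (n : ℝ) * (birk T g n x - birk T g n (T x))) atTop
      (𝓝 0) := by
    have h2 : Tendsto (fun n : ℕ => 2 * C / (n : ℝ)) atTop (𝓝 0) :=
      tendsto_const_div_atTop_nhds_zero_nat _
    apply squeeze_zero_norm _ h2
    intro n
    have e1 : birk T g n x - birk T g n (T x) = g x - g (T^[n] x) := by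
      have h1 := birk_succ' T g n x
      have h2 : birk T g (n + 1) x = birk T g n x + g (T^[n] x) := by
        simp [birk, Finset.sum_range_succ]
      linarith
    rw [e1, norm_mul, Real.norm_eq_abs, Real.norm_eq_abs, abs_of_nonneg (by positivity),
      one_div, inv_mul_eq_div]
    gcongr
    have := abs_le.1 (hC x)
    have := abs_le.1 (hC (T^[n] x))
    rw [abs_le]
    constructor <;> linarith
  have := limsup_sub_tendsto hb ht
  unfold upAvg
  rw [sub_zero] at this
  rw [← this]
  congr 1
  ext n
  ring

lemma upAvg_meas {T : α → α} {g : α → ℝ} (hT : Measurable T) (hg : Measurable g) :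
    Measurable (upAvg T g) :=
  Measurable.limsup fun n => (birk_meas hT hg n).const_mul _

lemma integral_upAvg_le {ν : Measure α} [IsProbabilityMeasure ν] {T : α → α}
    {g : α → ℝ} {C : ℝ}
    (hT : MeasurePreserving T ν ν) (hg : Measurable g) (hC : ∀ x, |g x| ≤ C) :
    ∫ x, upAvg T g x ∂ν ≤ ∫ x, g x ∂ν := by
  apply le_of_forall_pos_le_add
  intro ε hε
  have hu := upAvg_meas hT.measurable hg
  have hui : Integrable (upAvg T g) ν := integrable_of_abs hu (upAvg_abs_le hC)
  have hgi : Integrable g ν := integrable_of_abs hg hC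
  have hit : ∀ (i : ℕ) x, upAvg T g (T^[i] x) = upAvg T g x := by
    intro i
    induction i with
    | zero => intro x; rfl
    | succ i ih => intro x; rw [Function.iterate_succ_apply, ih, upAvg_comp hC]
  have := integral_nonneg_of_birk_pos (ν := ν) (T := T) (g := fun x => g x - upAvg T g x + ε)
    (C := C + C + ε) hT ((hg.sub hu).add_const ε) (by
      intro x
      have := abs_le.1 (hC x)
      have := abs_le.1 (upAvg_abs_le (T := T) hC x)
      rw [abs_le]
      constructor <;> linarith) (by
      intro x
      obtain ⟨u1, u2, u3, u4⟩ := bdd_of_abs (fun n => avg_abs_le (T := T) hC n x)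
      have hfr := frequently_lt_of_lt_limsup u3 (b := upAvg T g x - ε)
        (by change _ < upAvg T g x; linarith)
      obtain ⟨n, hn, hn0⟩ := (hfr.and_eventually (eventually_gt_atTop 0)).exists
      have hn' : (0 : ℝ) < n := by exact_mod_cast hn0
      refine ⟨n, ?_⟩
      have e : birk T (fun x => g x - upAvg T g x + ε) n x
          = birk T g n x - n * upAvg T g x + n * ε := by
        simp [birk, Finset.sum_add_distrib, hit]
      rw [e]
      rw [one_div, inv_mul_eq_div, lt_div_iff₀ hn'] at hn
      linarith)
  have e : ∫ x, (g x - upAvg T g x + ε) ∂ν = ∫ x, g x ∂ν - ∫ x, upAvg T g x ∂ν + ε := by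
    rw [integral_add (f := fun x => g x - upAvg T g x) (hgi.sub hui) (integrable_const ε),
      integral_sub hgi hui]
    simp
  rw [e] at this
  linarith

/-- Birkhoff's pointwise ergodic theorem for bounded measurable functions. -/
lemma birkhoff_pointwise {ν : Measure α} [IsProbabilityMeasure ν] {T : α → α}
    {g : α → ℝ} {C : ℝ}
    (hT : MeasurePreserving T ν ν) (hg : Measurable g) (hC : ∀ x, |g x| ≤ C) :
    (∀ᵐ x ∂ν, Tendsto (fun n : ℕ => 1 / (n : ℝ) * birk T g n x) atTop (𝓝 (upAvg T g x))) ∧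
    ∫ x, upAvg T g x ∂ν = ∫ x, g x ∂ν := by
  have hC' : ∀ x, |(-g) x| ≤ C := by intro x; simpa using hC x
  have h1 := integral_upAvg_le hT hg hC
  have h2 := integral_upAvg_le hT hg.neg hC'
  have i1 : Integrable (upAvg T g) ν :=
    integrable_of_abs (upAvg_meas hT.measurable hg) (upAvg_abs_le hC)
  have i2 : Integrable (upAvg T (-g)) ν :=
    integrable_of_abs (upAvg_meas hT.measurable hg.neg) (upAvg_abs_le hC')
  have hlow : ∀ x, liminf (fun n : ℕ => 1 / (n : ℝ) * birk T g n x) atTop = - upAvg T (-g) x := by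
    intro x
    obtain ⟨u1, u2, u3, u4⟩ := bdd_of_abs (fun n => avg_abs_le (T := T) hC' n x)
    have := (show Antitone (fun z : ℝ => -z) from fun a b hab => neg_le_neg hab).map_limsup_of_continuousAt (F := atTop)
      (fun n : ℕ => 1 / (n : ℝ) * birk T (-g) n x) continuous_neg.continuousAt u1 u3
    unfold upAvg
    rw [this]
    congr 1
    ext n
    simp [birk]
  have hle : ∀ x, - upAvg T (-g) x ≤ upAvg T g x := by
    intro x
    rw [← hlow]
    obtain ⟨u1, u2, u3, u4⟩ := bdd_of_abs (fun n => avg_abs_le (T := T) hC n x)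
    exact liminf_le_limsup u1 u2
  have hn : ∫ x, (-g) x ∂ν = - ∫ x, g x ∂ν := integral_neg g
  rw [hn] at h2
  have hs : 0 ≤ ∫ x, (upAvg T g x + upAvg T (-g) x) ∂ν :=
    integral_nonneg fun x => by simpa using (by linarith [hle x] : 0 ≤ upAvg T g x + upAvg T (-g) x)
  have hs' := integral_add i1 i2
  have hz : ∫ x, (upAvg T g x + upAvg T (-g) x) ∂ν = 0 := by linarith
  rw [integral_eq_zero_iff_of_nonneg (f := fun x => upAvg T g x + upAvg T (-g) x)
    (fun x => by simpa using (by linarith [hle x] : 0 ≤ upAvg T g x + upAvg T (-g) x)) (i1.add i2)] at hz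
  refine ⟨?_, by linarith⟩
  filter_upwards [hz] with x hx
  obtain ⟨u1, u2, u3, u4⟩ := bdd_of_abs (fun n => avg_abs_le (T := T) hC n x)
  refine tendsto_of_liminf_eq_limsup ?_ rfl u1 u2
  rw [hlow]
  simp only [Pi.zero_apply] at hx
  linarith

end Birkhoff

section Pressure

variable {k l : ℕ}

lemma gfun_meas (X : Set (ℕ → Fin k)) (σ : X → X) (πs : X → (ℕ → Fin l)) (f : X → ℝ) (n : ℕ) :
    Measurable (gfun X σ πs f n) := by
  let G : (Fin n → Fin l) → ℝ := fun w => sSup {s : ℝ | ∃ E : Finset X,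
    (∀ x ∈ E, ∀ i : Fin n, πs x (i : ℕ) = w i) ∧
    (∀ x ∈ E, ∀ x' ∈ E, (∀ i : Fin n, (x : ℕ → Fin k) (i : ℕ) = (x' : ℕ → Fin k) (i : ℕ)) →
      x = x') ∧
    (∀ u : Fin n → Fin k,
      (∃ z : X, (∀ i : Fin n, (z : ℕ → Fin k) (i : ℕ) = u i) ∧
        ∀ i : Fin n, πs z (i : ℕ) = w i) →
      ∃ x ∈ E, ∀ i : Fin n, (x : ℕ → Fin k) (i : ℕ) = u i) ∧
    s = ∑ x ∈ E, Real.exp (birk σ f n x)}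
  have hG : Measurable G := Measurable.of_discrete
  have hr : Measurable (fun (y : ℕ → Fin l) (i : Fin n) => y (i : ℕ)) :=
    measurable_pi_lambda _ fun i => measurable_pi_apply _
  exact hG.comp hr

lemma iter_shift {X : Set (ℕ → Fin k)} {σ : X → X}
    (hσ : ∀ x : X, (σ x : ℕ → Fin k) = shiftMap (x : ℕ → Fin k)) (i : ℕ) (x : X) (j : ℕ) :
    ((σ^[i] x : X) : ℕ → Fin k) j = (x : ℕ → Fin k) (i + j) := by
  induction i generalizing x with
  | zero => simp
  | succ i ih =>
    rw [Function.iterate_succ_apply, ih, hσ]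
    simp only [shiftMap]
    rw [show i + j + 1 = i + 1 + j by omega]

/-- Points separated at scale above `(1/2)^m` within time `n` have different `(n+m)`-prefixes. -/
lemma sep_prefix {X : Set (ℕ → Fin k)} {σ : X → X}
    (hσ : ∀ x : X, (σ x : ℕ → Fin k) = shiftMap (x : ℕ → Fin k)) {δ : ℝ} (hδ : 0 < δ) {m : ℕ}
    (hm : (1 / 2 : ℝ) ^ m < δ) {n i : ℕ} (hi : i < n) {x x' : X}
    (hd : δ ≤ dSeq ((σ^[i] x : X) : ℕ → Fin k) ((σ^[i] x' : X) : ℕ → Fin k)) :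
    ∃ j < n + m, (x : ℕ → Fin k) j ≠ (x' : ℕ → Fin k) j := by
  unfold dSeq at hd
  split_ifs at hd with he
  · linarith
  · have hne : {j : ℕ | ((σ^[i] x : X) : ℕ → Fin k) j ≠ ((σ^[i] x' : X) : ℕ → Fin k) j}.Nonempty :=
      Function.ne_iff.1 he
    have hmem := Nat.sInf_mem hne
    set j := sInf {j : ℕ | ((σ^[i] x : X) : ℕ → Fin k) j ≠ ((σ^[i] x' : X) : ℕ → Fin k) j}
    have hj : ((σ^[i] x : X) : ℕ → Fin k) j ≠ ((σ^[i] x' : X) : ℕ → Fin k) j := hmem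
    rw [iter_shift hσ, iter_shift hσ] at hj
    have hjm : j < m := by
      have h1 : (1 / 2 : ℝ) ^ m < (1 / 2 : ℝ) ^ j := hm.trans_le hd
      exact (pow_lt_pow_iff_right_of_lt_one₀ (by norm_num) (by norm_num)).1 h1
    exact ⟨i + j, by omega, hj⟩

/-- The set of sums whose supremum is `relPn`. -/
def sumSet (X : Set (ℕ → Fin k)) (σ : X → X)
    (πs : X → (ℕ → Fin l)) (f : X → ℝ) (n : ℕ) (δ : ℝ) (y : ℕ → Fin l) : Set ℝ :=
  {s : ℝ | ∃ E : Finset X, (∀ x ∈ E, πs x = y) ∧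
    (∀ x ∈ E, ∀ x' ∈ E, x ≠ x' →
      ∃ i < n, δ ≤ dSeq ((σ^[i] x : X) : ℕ → Fin k) ((σ^[i] x' : X) : ℕ → Fin k)) ∧
    s = ∑ x ∈ E, Real.exp (birk σ f n x)}

lemma sumSet_le {X : Set (ℕ → Fin k)} {σ : X → X}
    (hσ : ∀ x : X, (σ x : ℕ → Fin k) = shiftMap (x : ℕ → Fin k))
    (πs : X → (ℕ → Fin l)) {f : X → ℝ} {C : ℝ} (hC : ∀ x, |f x| ≤ C) {δ : ℝ} (hδ : 0 < δ) {m : ℕ}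
    (hm : (1 / 2 : ℝ) ^ m < δ) (n : ℕ) (y : ℕ → Fin l) :
    ∀ s ∈ sumSet X σ πs f n δ y, s ≤ (k : ℝ) ^ (n + m) * Real.exp (n * C) := by
  rintro s ⟨E, -, hsep, rfl⟩
  have hcard : E.card ≤ k ^ (n + m) := by
    have : E.card ≤ (Finset.univ : Finset (Fin (n + m) → Fin k)).card := by
      refine Finset.card_le_card_of_injOn
        (fun (x : X) (i : Fin (n + m)) => (x : ℕ → Fin k) (i : ℕ))
        (fun _ _ => Finset.mem_coe.2 (Finset.mem_univ _)) ?_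
      intro x hx x' hx' hxx
      by_contra hne
      obtain ⟨i, hi, hd⟩ := hsep x hx x' hx' hne
      obtain ⟨j, hj, hjne⟩ := sep_prefix hσ hδ hm hi hd
      exact hjne (congrFun hxx ⟨j, hj⟩)
    simpa using this
  calc ∑ x ∈ E, Real.exp (birk σ f n x) ≤ ∑ x ∈ E, Real.exp (n * C) := by
        apply Finset.sum_le_sum
        intro x _
        exact Real.exp_le_exp.2 (abs_le.1 (birk_abs_le hC n x)).2
    _ = E.card * Real.exp (n * C) := by simp
    _ ≤ (k : ℝ) ^ (n + m) * Real.exp (n * C) := by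
        gcongr
        exact_mod_cast hcard

lemma relPn_bounds {X : Set (ℕ → Fin k)} {σ : X → X}
    (hσ : ∀ x : X, (σ x : ℕ → Fin k) = shiftMap (x : ℕ → Fin k))
    {πs : X → (ℕ → Fin l)} {f : X → ℝ} {C : ℝ} (hC : ∀ x, |f x| ≤ C) {δ : ℝ} (hδ : 0 < δ) {m : ℕ}
    (hm : (1 / 2 : ℝ) ^ m < δ) (n : ℕ) {y : ℕ → Fin l} (hy : ∃ x, πs x = y) :
    Real.exp (-(n * C)) ≤ relPn X σ πs f n δ y ∧
      relPn X σ πs f n δ y ≤ (k : ℝ) ^ (n + m) * Real.exp (n * C) := by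
  obtain ⟨x, hx⟩ := hy
  have hb := sumSet_le hσ πs hC hδ hm n y
  have hmem : Real.exp (birk σ f n x) ∈ sumSet X σ πs f n δ y := by
    refine ⟨{x}, by simpa using hx, ?_, by simp⟩
    intro a ha b hb hne
    rw [Finset.mem_singleton] at ha hb
    exact absurd (ha.trans hb.symm) hne
  constructor
  · refine le_trans ?_ (le_csSup ⟨_, hb⟩ hmem)
    exact Real.exp_le_exp.2 (abs_le.1 (birk_abs_le hC n x)).1
  · exact csSup_le ⟨_, hmem⟩ hb

lemma log_relPn_bounds {X : Set (ℕ → Fin k)} {σ : X → X}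
    (hσ : ∀ x : X, (σ x : ℕ → Fin k) = shiftMap (x : ℕ → Fin k))
    {πs : X → (ℕ → Fin l)} {f : X → ℝ} {C : ℝ} (hC : ∀ x, |f x| ≤ C) {δ : ℝ} (hδ : 0 < δ) {m : ℕ}
    (hm : (1 / 2 : ℝ) ^ m < δ) (n : ℕ) {y : ℕ → Fin l} (hy : ∃ x, πs x = y) :
    -C ≤ 1 / (n : ℝ) * Real.log (relPn X σ πs f n δ y) ∧
      1 / (n : ℝ) * Real.log (relPn X σ πs f n δ y) ≤
        Real.log k + C + m * Real.log k / n := by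
  obtain ⟨h1, h2⟩ := relPn_bounds hσ hC hδ hm n hy
  have hx := hy.choose
  have hk : 0 < k := (Nat.zero_le _).trans_lt ((hx : ℕ → Fin k) 0).2
  have hk' : (0 : ℝ) < k := by exact_mod_cast hk
  have hlk : 0 ≤ Real.log k := Real.log_natCast_nonneg k
  have hC0 : 0 ≤ C := (abs_nonneg _).trans (hC hx)
  rcases Nat.eq_zero_or_pos n with rfl | hn
  · simp; constructor <;> positivity
  have hn' : (0 : ℝ) < n := by exact_mod_cast hn
  have hp : 0 < relPn X σ πs f n δ y := (Real.exp_pos _).trans_le h1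
  have l1 : -(n * C) ≤ Real.log (relPn X σ πs f n δ y) := (Real.le_log_iff_exp_le hp).2 h1
  have l2 : Real.log (relPn X σ πs f n δ y) ≤ (n + m) * Real.log k + n * C := by
    refine (Real.log_le_log hp h2).trans_eq ?_
    rw [Real.log_mul (by positivity) (by positivity), Real.log_pow, Real.log_exp]
    push_cast
    rfl
  rw [one_div, inv_mul_eq_div]
  constructor
  · rw [le_div_iff₀ hn']; linarith
  · rw [div_le_iff₀ hn']
    have : (Real.log k + C + m * Real.log k / n) * n = (n + m) * Real.log k + n * C := by
      field_simp
      ring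
    linarith

open scoped Pointwise in
lemma relPn_sub {X : Set (ℕ → Fin k)} {σ : X → X}
    {πs : X → (ℕ → Fin l)} {f g : X → ℝ} {n : ℕ} {y : ℕ → Fin l} {S : ℝ} (δ : ℝ)
    (hg : ∀ x, πs x = y → birk σ g n x = birk σ f n x - S) :
    relPn X σ πs g n δ y = Real.exp (-S) * relPn X σ πs f n δ y := by
  have hs : ∀ E : Finset X, (∀ x ∈ E, πs x = y) →
      ∑ x ∈ E, Real.exp (birk σ g n x) = Real.exp (-S) * ∑ x ∈ E, Real.exp (birk σ f n x) := by
    intro E hE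
    rw [Finset.mul_sum]
    refine Finset.sum_congr rfl fun x hx => ?_
    rw [hg x (hE x hx), ← Real.exp_add]
    congr 1
    ring
  have : sumSet X σ πs g n δ y = Real.exp (-S) • sumSet X σ πs f n δ y := by
    ext s
    rw [Set.mem_smul_set]
    constructor
    · rintro ⟨E, h1, h2, rfl⟩
      exact ⟨_, ⟨E, h1, h2, rfl⟩, (hs E h1).symm⟩
    · rintro ⟨_, ⟨E, h1, h2, rfl⟩, rfl⟩
      exact ⟨E, h1, h2, (hs E h1).symm⟩
  change sSup (sumSet X σ πs g n δ y) = Real.exp (-S) • sSup (sumSet X σ πs f n δ y)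
  rw [this, Real.sSup_smul_of_nonneg (Real.exp_pos _).le]

/-- Subtracting a function of the base shifts the relative pressure by its Birkhoff average. -/
lemma relP_sub {X : Set (ℕ → Fin k)} {σ : X → X}
    (hσ : ∀ x : X, (σ x : ℕ → Fin k) = shiftMap (x : ℕ → Fin k))
    {πs : X → (ℕ → Fin l)} {f g : X → ℝ} {C : ℝ} (hC : ∀ x, |f x| ≤ C)
    {y : ℕ → Fin l} (hy : ∃ x, πs x = y) {S : ℕ → ℝ} {c : ℝ}
    (hS : Tendsto (fun n : ℕ => 1 / (n : ℝ) * S n) atTop (𝓝 c))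
    (hg : ∀ n x, πs x = y → birk σ g n x = birk σ f n x - S n) :
    relP X σ πs g y = relP X σ πs f y - c := by
  have hx := hy.choose
  have hlk : 0 ≤ Real.log k := Real.log_natCast_nonneg k
  have hm : ∀ δ : {δ : ℝ // 0 < δ}, ∃ m : ℕ, (1 / 2 : ℝ) ^ m < δ.1 := fun δ =>
    exists_pow_lt_of_lt_one δ.2 (by norm_num)
  have hC0 : 0 ≤ C := (abs_nonneg _).trans (hC hx)
  have hbd : ∀ δ : {δ : ℝ // 0 < δ}, ∃ D, ∀ n : ℕ,
      |1 / (n : ℝ) * Real.log (relPn X σ πs f n δ.1 y)| ≤ D := by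
    intro δ
    obtain ⟨m, hm⟩ := hm δ
    refine ⟨Real.log k + C + m * Real.log k, fun n => ?_⟩
    obtain ⟨h1, h2⟩ := log_relPn_bounds hσ hC δ.2 hm n hy
    have hmk : 0 ≤ m * Real.log k := by positivity
    have : m * Real.log k / n ≤ m * Real.log k := by
      rcases Nat.eq_zero_or_pos n with rfl | hn
      · simpa using hmk
      · exact div_le_self hmk (by exact_mod_cast hn)
    rw [abs_le]
    constructor <;> linarith
  unfold relP
  have : Nonempty {δ : ℝ // 0 < δ} := ⟨⟨1, one_pos⟩⟩
  rw [ciSup_sub]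
  · congr 1
    ext δ
    obtain ⟨D, hD⟩ := hbd δ
    obtain ⟨m, hm⟩ := hm δ
    rw [← limsup_sub_tendsto hD hS]
    congr 1
    ext n
    have hp : 0 < relPn X σ πs f n δ.1 y :=
      (Real.exp_pos _).trans_le (relPn_bounds hσ hC δ.2 hm n hy).1
    rw [relPn_sub δ.1 (hg n), Real.log_mul (Real.exp_pos _).ne' hp.ne', Real.log_exp]
    ring
  · refine ⟨Real.log k + C, ?_⟩
    rintro _ ⟨δ, rfl⟩
    obtain ⟨D, hD⟩ := hbd δ
    obtain ⟨m, hm⟩ := hm δ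
    obtain ⟨u1, u2, u3, u4⟩ := bdd_of_abs hD
    have ht : Tendsto (fun n : ℕ => Real.log k + C + m * Real.log k / n) atTop
        (𝓝 (Real.log k + C)) := by
      simpa using (tendsto_const_div_atTop_nhds_zero_nat (m * Real.log k)).const_add
        (Real.log k + C)
    rw [← ht.limsup_eq]
    exact limsup_le_limsup (Eventually.of_forall fun n =>
      (log_relPn_bounds hσ hC δ.2 hm n hy).2) u3 ht.isBoundedUnder_le

end Pressure

theorem stmt14 {k l : ℕ}
    (X : Set (ℕ → Fin k)) (hX : IsSubshift X)
    (Y : Set (ℕ → Fin l)) (hY : IsSubshift Y)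
    (σX : X → X) (hσX : ∀ x : X, (σX x : ℕ → Fin k) = shiftMap (x : ℕ → Fin k))
    (σY : Y → Y) (hσY : ∀ y : Y, (σY y : ℕ → Fin l) = shiftMap (y : ℕ → Fin l))
    -- π is a one-block factor map
    (π : X → Y) (hπc : Continuous π) (hπs : Function.Surjective π)
    (hπcomm : ∀ x, π (σX x) = σY (π x))
    (hπ1 : ∃ τ : Fin k → Fin l, ∀ (x : X) (i : ℕ), (π x : ℕ → Fin l) i = τ ((x : ℕ → Fin k) i))
    (f : X → ℝ) (hf : Continuous f)
    (h : Y → ℝ) (hh : Continuous h)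
    -- P(σ_X, π, f)(y) = limsup (1/n) log g_n(y) holds m-a.e. for every invariant m
    (hpesh : ∀ ν : Measure Y, IsProbabilityMeasure ν → MeasurePreserving σY ν ν →
      ∀ᵐ (y : ↥Y) ∂ν, relP X σX (fun z => ((π z : ℕ → Fin l))) f ((y : ℕ → Fin l)) =
        Filter.limsup
          (fun n : ℕ => (1 / (n : ℝ)) *
            Real.log (gfun X σX (fun z => ((π z : ℕ → Fin l))) f n ((y : ℕ → Fin l))))
          Filter.atTop)
    -- m({y : P(σ_X, π, f - h∘π)(y) = 0}) = 1 for every invariant m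
    (hzero : ∀ ν : Measure Y, IsProbabilityMeasure ν → MeasurePreserving σY ν ν →
      ν {y : ↥Y | relP X σX (fun z => ((π z : ℕ → Fin l))) (fun x => f x - h (π x))
        ((y : ℕ → Fin l)) = 0} = 1) :
    ∀ ν : Measure Y, IsProbabilityMeasure ν → MeasurePreserving σY ν ν →
      ∫ y, relP X σX (fun z => ((π z : ℕ → Fin l))) f ((y : ℕ → Fin l)) ∂ν = ∫ y, h y ∂ν := by
  intro ν hν hT
  have hXc : CompactSpace X := isCompact_iff_compactSpace.1 hX.1.isCompact
  have hYc : CompactSpace Y := isCompact_iff_compactSpace.1 hY.1.isCompact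
  obtain ⟨C, hC⟩ : ∃ C, ∀ x, |f x| ≤ C := by
    obtain ⟨C, hC⟩ := isCompact_univ.exists_bound_of_continuousOn hf.continuousOn
    exact ⟨C, fun x => hC x (Set.mem_univ x)⟩
  obtain ⟨D, hD⟩ : ∃ D, ∀ y, |h y| ≤ D := by
    obtain ⟨D, hD⟩ := isCompact_univ.exists_bound_of_continuousOn hh.continuousOn
    exact ⟨D, fun x => hD x (Set.mem_univ x)⟩
  obtain ⟨hB, hI⟩ := birkhoff_pointwise hT hh.measurable hD
  have hiter : ∀ (i : ℕ) (x : X), π (σX^[i] x) = σY^[i] (π x) := by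
    intro i
    induction i with
    | zero => intro x; rfl
    | succ i ih => intro x; rw [Function.iterate_succ_apply, ih, hπcomm, Function.iterate_succ_apply]
  -- the two relative pressures differ by the Birkhoff average of `h`
  have hsub : ∀ᵐ (y : ↥Y) ∂ν,
      relP X σX (fun z => ((π z : ℕ → Fin l))) (fun x => f x - h (π x)) (y : ℕ → Fin l) =
        relP X σX (fun z => ((π z : ℕ → Fin l))) f (y : ℕ → Fin l) - upAvg σY h y := by
    filter_upwards [hB] with y hy
    obtain ⟨x₀, hx₀⟩ := hπs y
    refine relP_sub hσX hC ⟨x₀, by rw [hx₀]⟩ hy ?_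
    intro n x hx
    have hx' : π x = y := Subtype.ext hx
    simp only [birk, Finset.sum_sub_distrib, hiter, hx']
  have hup : Measurable (upAvg σY h) := upAvg_meas hT.measurable hh.measurable
  have hmf : AEMeasurable
      (fun y : Y => relP X σX (fun z => ((π z : ℕ → Fin l))) f (y : ℕ → Fin l)) ν := by
    refine ⟨_, ?_, hpesh ν hν hT⟩
    exact Measurable.limsup fun n =>
      ((Real.measurable_log.comp ((gfun_meas X σX _ f n).comp measurable_subtype_coe))).const_mul _
  have hmg : AEMeasurable
      (fun y : Y => relP X σX (fun z => ((π z : ℕ → Fin l))) (fun x => f x - h (π x))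
        (y : ℕ → Fin l)) ν :=
    (hmf.sub hup.aemeasurable).congr (hsub.mono fun y hy => hy.symm)
  have hz : ∀ᵐ (y : ↥Y) ∂ν,
      relP X σX (fun z => ((π z : ℕ → Fin l))) (fun x => f x - h (π x)) (y : ℕ → Fin l) = 0 :=
    (mem_ae_iff_prob_eq_one₀ (hmg.nullMeasurable (measurableSet_singleton 0))).2 (hzero ν hν hT)
  rw [← hI]
  apply integral_congr_ae
  filter_upwards [hsub, hz] with y h1 h2
  linarith
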